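/- For every t > 0 and x ∈ ℝ, the function t ↦ ∫₀¹ g_t(x,y)² dy is differentiable and ∂/∂t ∫₀¹ g_t(x,y)² dy = ∫₀¹ g_t(x,y)·(∂²/∂x² g_t)(x,y) dy = −Σ_{n=1}^∞ 2·n²π²·exp(−n²π²t)·sin²(nπx), where ∂²/∂x² g_t denotes the second derivative of g_t in its first spatial variable. -/

import Mathlib

open Real MeasureTheory

/-- The Dirichlet heat kernel on `[0,1]`:
`g_t(x,y) = ∑_{n=1}^∞ 2 exp(−n²π²t/2) sin(nπx) sin(nπy)` (indexed here by `n+1`, `n : ℕ`). -/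
noncomputable def heatKernel (t x y : ℝ) : ℝ :=
  ∑' n : ℕ, 2 * Real.exp (-(((n : ℝ) + 1) ^ 2 * π ^ 2 * t) / 2) *
    Real.sin (((n : ℝ) + 1) * π * x) * Real.sin (((n : ℝ) + 1) * π * y)

theorem integral_cos_int_mul_pi_mul {k : ℤ} (hk : k ≠ 0) :
    ∫ y in (0:ℝ)..1, Real.cos (k * π * y) = 0 := by
  have h : (k : ℝ) * π ≠ 0 := mul_ne_zero (by exact_mod_cast hk) pi_ne_zero
  rw [intervalIntegral.integral_comp_mul_left (fun z => Real.cos z) h, integral_cos]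
  simp [Real.sin_int_mul_pi]

/-- Orthogonality of the Dirichlet eigenfunctions on `[0,1]`. -/
theorem integral_sin_mul_sin_nat_succ (n m : ℕ) :
    ∫ y in (0:ℝ)..1, Real.sin (((n : ℝ) + 1) * π * y) * Real.sin (((m : ℝ) + 1) * π * y) =
      if n = m then 1 / 2 else 0 := by
  have hprod : ∀ y : ℝ, Real.sin (((n : ℝ) + 1) * π * y) * Real.sin (((m : ℝ) + 1) * π * y) =
      (1 / 2) * (Real.cos (((n - m : ℤ) : ℝ) * π * y) -
        Real.cos (((n + m + 2 : ℤ) : ℝ) * π * y)) := by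
    intro y
    have h1 : ((n - m : ℤ) : ℝ) * π * y = ((n : ℝ) + 1) * π * y - ((m : ℝ) + 1) * π * y := by
      push_cast; ring
    have h2 : ((n + m + 2 : ℤ) : ℝ) * π * y = ((n : ℝ) + 1) * π * y + ((m : ℝ) + 1) * π * y := by
      push_cast; ring
    rw [h1, h2, Real.cos_sub, Real.cos_add]
    ring
  simp_rw [hprod]
  rw [intervalIntegral.integral_const_mul, intervalIntegral.integral_sub
    (Continuous.intervalIntegrable (by fun_prop) _ _)
    (Continuous.intervalIntegrable (by fun_prop) _ _),
    integral_cos_int_mul_pi_mul (k := n + m + 2) (by lia)]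
  split_ifs with h
  · subst h
    simp
  · rw [integral_cos_int_mul_pi_mul (by lia)]
    simp

theorem continuous_tsum_mul_sin {a : ℕ → ℝ} (ha : Summable fun n => |a n|) :
    Continuous fun y : ℝ => ∑' n, a n * Real.sin (((n : ℝ) + 1) * π * y) := by
  refine continuous_tsum (fun n => by fun_prop) ha fun n y => ?_
  rw [norm_mul, Real.norm_eq_abs, Real.norm_eq_abs]
  exact mul_le_of_le_one_right (abs_nonneg _) (Real.abs_sin_le_one _)

theorem summable_mul_sin {a : ℕ → ℝ} (ha : Summable fun n => |a n|) (y : ℝ) :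
    Summable fun n : ℕ => a n * Real.sin (((n : ℝ) + 1) * π * y) := by
  refine Summable.of_norm_bounded ha fun n => ?_
  rw [norm_mul, Real.norm_eq_abs, Real.norm_eq_abs]
  exact mul_le_of_le_one_right (abs_nonneg _) (Real.abs_sin_le_one _)

theorem integral_tsum_mul_sin_mul {a : ℕ → ℝ} (ha : Summable fun n => |a n|) {f : ℝ → ℝ}
    (hf : Continuous f) :
    ∫ y in (0:ℝ)..1, (∑' n, a n * Real.sin (((n : ℝ) + 1) * π * y)) * f y =
      ∑' n, a n * ∫ y in (0:ℝ)..1, Real.sin (((n : ℝ) + 1) * π * y) * f y := by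
  have h := intervalIntegral.hasSum_integral_of_dominated_convergence
    (μ := volume) (a := 0) (b := 1)
    (F := fun (n : ℕ) (y : ℝ) => a n * Real.sin (((n : ℝ) + 1) * π * y) * f y)
    (f := fun y => (∑' n, a n * Real.sin (((n : ℝ) + 1) * π * y)) * f y)
    (fun n y => |a n| * |f y|)
    (fun n => Continuous.aestronglyMeasurable (by fun_prop))
    (fun n => Filter.Eventually.of_forall fun y _ => by
      rw [norm_mul, norm_mul, Real.norm_eq_abs, Real.norm_eq_abs, Real.norm_eq_abs]
      gcongr
      exact mul_le_of_le_one_right (abs_nonneg _) (Real.abs_sin_le_one _))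
    (Filter.Eventually.of_forall fun y _ => ha.mul_right _)
    (by
      simp_rw [tsum_mul_right]
      exact Continuous.intervalIntegrable (by fun_prop) _ _)
    (Filter.Eventually.of_forall fun y _ => (summable_mul_sin ha y).hasSum.mul_right _)
  rw [← h.tsum_eq]
  simp_rw [mul_assoc (a _), intervalIntegral.integral_const_mul]

/-- Parseval's identity for absolutely convergent sine series. -/
theorem integral_tsum_mul_sin_mul_tsum_mul_sin {a b : ℕ → ℝ} (ha : Summable fun n => |a n|)
    (hb : Summable fun n => |b n|) :
    ∫ y in (0:ℝ)..1, (∑' n, a n * Real.sin (((n : ℝ) + 1) * π * y)) *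
      (∑' n, b n * Real.sin (((n : ℝ) + 1) * π * y)) = ∑' n, a n * b n / 2 := by
  rw [integral_tsum_mul_sin_mul ha (continuous_tsum_mul_sin hb)]
  refine tsum_congr fun n => ?_
  simp_rw [mul_comm (Real.sin (((n : ℝ) + 1) * π * _))]
  rw [integral_tsum_mul_sin_mul hb (by fun_prop)]
  simp_rw [integral_sin_mul_sin_nat_succ]
  rw [tsum_eq_single n fun m hm => by simp [hm]]
  simp
  ring

theorem summable_pow_mul_exp_neg_sq (k : ℕ) {r : ℝ} (hr : 0 < r) :
    Summable fun n : ℕ => ((n : ℝ) + 1) ^ k * Real.exp (-(((n : ℝ) + 1) ^ 2 * r)) := by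
  have h := (summable_nat_add_iff 1).mpr (Real.summable_pow_mul_exp_neg_nat_mul k hr)
  refine Summable.of_nonneg_of_le (fun n => by positivity) (fun n => ?_) h
  push_cast
  gcongr
  nlinarith [mul_nonneg (mul_nonneg n.cast_nonneg (n.cast_nonneg.trans (lt_add_one (n : ℝ)).le))
    hr.le]

theorem summable_const_mul_pow_mul_exp (C : ℝ) (k : ℕ) {t : ℝ} (ht : 0 < t) :
    Summable fun n : ℕ =>
      C * (((n : ℝ) + 1) ^ k * Real.exp (-(((n : ℝ) + 1) ^ 2 * π ^ 2 * t) / 2)) := by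
  refine ((summable_pow_mul_exp_neg_sq k (r := π ^ 2 * t / 2) (by positivity)).mul_left C).congr
    fun n => ?_
  congr 3
  ring

theorem heatKernel_eq_tsum_mul_sin (t x y : ℝ) :
    heatKernel t x y = ∑' n : ℕ, (2 * Real.exp (-(((n : ℝ) + 1) ^ 2 * π ^ 2 * t) / 2) *
      Real.sin (((n : ℝ) + 1) * π * x)) * Real.sin (((n : ℝ) + 1) * π * y) := rfl

theorem summable_abs_heatKernel_coeff {t : ℝ} (ht : 0 < t) (x : ℝ) :
    Summable fun n : ℕ => |2 * Real.exp (-(((n : ℝ) + 1) ^ 2 * π ^ 2 * t) / 2) *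
      Real.sin (((n : ℝ) + 1) * π * x)| := by
  refine Summable.of_nonneg_of_le (fun n => abs_nonneg _) (fun n => ?_)
    (summable_const_mul_pow_mul_exp 2 0 ht)
  rw [abs_mul, abs_of_nonneg (by positivity : (0:ℝ) ≤ 2 * Real.exp _), pow_zero, one_mul]
  exact mul_le_of_le_one_right (by positivity) (Real.abs_sin_le_one _)

theorem summable_abs_heatKernel_deriv_coeff {t : ℝ} (ht : 0 < t) (x : ℝ) :
    Summable fun n : ℕ => |-(2 * Real.exp (-(((n : ℝ) + 1) ^ 2 * π ^ 2 * t) / 2) *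
      (((n : ℝ) + 1) * π) ^ 2 * Real.sin (((n : ℝ) + 1) * π * x))| := by
  refine Summable.of_nonneg_of_le (fun n => abs_nonneg _) (fun n => ?_)
    (summable_const_mul_pow_mul_exp (2 * π ^ 2) 2 ht)
  rw [abs_neg, abs_mul, abs_of_nonneg (by positivity : (0:ℝ) ≤ 2 * Real.exp _ * _)]
  refine (mul_le_of_le_one_right (by positivity) (Real.abs_sin_le_one _)).trans (le_of_eq ?_)
  ring

theorem norm_heatKernel_deriv_term_le (n : ℕ) (t x y : ℝ) :
    ‖2 * Real.exp (-(((n : ℝ) + 1) ^ 2 * π ^ 2 * t) / 2) *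
      (Real.cos (((n : ℝ) + 1) * π * x) * (((n : ℝ) + 1) * π)) *
        Real.sin (((n : ℝ) + 1) * π * y)‖ ≤
      2 * π * (((n : ℝ) + 1) ^ 1 * Real.exp (-(((n : ℝ) + 1) ^ 2 * π ^ 2 * t) / 2)) := by
  have h : |Real.cos (((n : ℝ) + 1) * π * x)| * |Real.sin (((n : ℝ) + 1) * π * y)| ≤ 1 :=
    mul_le_one₀ (Real.abs_cos_le_one _) (abs_nonneg _) (Real.abs_sin_le_one _)
  have hc : (0:ℝ) ≤ 2 * π * (((n : ℝ) + 1) ^ 1 *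
      Real.exp (-(((n : ℝ) + 1) ^ 2 * π ^ 2 * t) / 2)) := by positivity
  refine le_of_eq_of_le ?_ (mul_le_of_le_one_right hc h)
  rw [Real.norm_eq_abs, ← abs_mul, ← abs_of_nonneg hc, ← abs_mul]
  congr 1
  ring

theorem hasDerivAt_heatKernel {t : ℝ} (ht : 0 < t) (x y : ℝ) :
    HasDerivAt (fun x' => heatKernel t x' y)
      (∑' n : ℕ, 2 * Real.exp (-(((n : ℝ) + 1) ^ 2 * π ^ 2 * t) / 2) *
        (Real.cos (((n : ℝ) + 1) * π * x) * (((n : ℝ) + 1) * π)) *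
          Real.sin (((n : ℝ) + 1) * π * y)) x := by
  refine hasDerivAt_tsum (F := ℝ)
    (g := fun (n : ℕ) (z : ℝ) => 2 * Real.exp (-(((n : ℝ) + 1) ^ 2 * π ^ 2 * t) / 2) *
      Real.sin (((n : ℝ) + 1) * π * z) * Real.sin (((n : ℝ) + 1) * π * y))
    (g' := fun (n : ℕ) (z : ℝ) => 2 * Real.exp (-(((n : ℝ) + 1) ^ 2 * π ^ 2 * t) / 2) *
      (Real.cos (((n : ℝ) + 1) * π * z) * (((n : ℝ) + 1) * π)) * Real.sin (((n : ℝ) + 1) * π * y))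
    (summable_const_mul_pow_mul_exp (2 * π) 1 ht) (fun n z => ?_)
    (fun n z => ?_) (summable_mul_sin (summable_abs_heatKernel_coeff ht x) y) x
  · have h : HasDerivAt (fun z : ℝ => ((n : ℝ) + 1) * π * z) (((n : ℝ) + 1) * π) z := by
      simpa using (hasDerivAt_id z).const_mul (((n : ℝ) + 1) * π)
    exact (h.sin.const_mul _).mul_const _
  · exact norm_heatKernel_deriv_term_le n t z y

theorem deriv_deriv_heatKernel {t : ℝ} (ht : 0 < t) (x y : ℝ) :
    deriv (deriv fun x' => heatKernel t x' y) x =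
      ∑' n : ℕ, -(2 * Real.exp (-(((n : ℝ) + 1) ^ 2 * π ^ 2 * t) / 2) *
        (((n : ℝ) + 1) * π) ^ 2 * Real.sin (((n : ℝ) + 1) * π * x)) *
          Real.sin (((n : ℝ) + 1) * π * y) := by
  rw [funext fun z => (hasDerivAt_heatKernel ht z y).deriv]
  refine (hasDerivAt_tsum (F := ℝ)
    (g := fun (n : ℕ) (z : ℝ) => 2 * Real.exp (-(((n : ℝ) + 1) ^ 2 * π ^ 2 * t) / 2) *
      (Real.cos (((n : ℝ) + 1) * π * z) * (((n : ℝ) + 1) * π)) * Real.sin (((n : ℝ) + 1) * π * y))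
    (g' := fun (n : ℕ) (z : ℝ) => -(2 * Real.exp (-(((n : ℝ) + 1) ^ 2 * π ^ 2 * t) / 2) *
      (((n : ℝ) + 1) * π) ^ 2 * Real.sin (((n : ℝ) + 1) * π * z)) * Real.sin (((n : ℝ) + 1) * π * y))
    (summable_const_mul_pow_mul_exp (2 * π ^ 2) 2 ht) (fun n z => ?_)
    (fun n z => ?_) (y₀ := x) ?_ x).deriv
  · have h : HasDerivAt (fun z : ℝ => ((n : ℝ) + 1) * π * z) (((n : ℝ) + 1) * π) z := by
      simpa using (hasDerivAt_id z).const_mul (((n : ℝ) + 1) * π)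
    exact (((h.cos.mul_const (((n : ℝ) + 1) * π)).const_mul
      (2 * Real.exp (-(((n : ℝ) + 1) ^ 2 * π ^ 2 * t) / 2))).mul_const
        (Real.sin (((n : ℝ) + 1) * π * y))).congr_deriv (by ring)
  · rw [Real.norm_eq_abs]
    have h : |Real.sin (((n : ℝ) + 1) * π * z)| * |Real.sin (((n : ℝ) + 1) * π * y)| ≤ 1 :=
      mul_le_one₀ (Real.abs_sin_le_one _) (abs_nonneg _) (Real.abs_sin_le_one _)
    have hc : (0:ℝ) ≤ 2 * π ^ 2 * (((n : ℝ) + 1) ^ 2 *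
        Real.exp (-(((n : ℝ) + 1) ^ 2 * π ^ 2 * t) / 2)) := by positivity
    refine le_of_eq_of_le ?_ (mul_le_of_le_one_right hc h)
    rw [← abs_mul, ← abs_of_nonneg hc, ← abs_mul, ← abs_neg]
    congr 1
    ring
  · refine Summable.of_norm_bounded (summable_const_mul_pow_mul_exp (2 * π) 1 ht) fun n =>
      norm_heatKernel_deriv_term_le n t x y

theorem integral_heatKernel_sq {t : ℝ} (ht : 0 < t) (x : ℝ) :
    ∫ y in (0:ℝ)..1, heatKernel t x y ^ 2 =
      ∑' n : ℕ, 2 * Real.exp (-(((n : ℝ) + 1) ^ 2 * π ^ 2 * t)) *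
        Real.sin (((n : ℝ) + 1) * π * x) ^ 2 := by
  simp_rw [sq (heatKernel _ _ _), heatKernel_eq_tsum_mul_sin]
  rw [integral_tsum_mul_sin_mul_tsum_mul_sin (summable_abs_heatKernel_coeff ht x)
    (summable_abs_heatKernel_coeff ht x)]
  refine tsum_congr fun n => ?_
  rw [show -(((n : ℝ) + 1) ^ 2 * π ^ 2 * t) = -(((n : ℝ) + 1) ^ 2 * π ^ 2 * t) / 2 +
    -(((n : ℝ) + 1) ^ 2 * π ^ 2 * t) / 2 by ring, Real.exp_add]
  ring_nf

theorem integral_heatKernel_mul_deriv_deriv {t : ℝ} (ht : 0 < t) (x : ℝ) :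
    ∫ y in (0:ℝ)..1, heatKernel t x y * deriv (deriv fun x' => heatKernel t x' y) x =
      ∑' n : ℕ, 2 * (Real.exp (-(((n : ℝ) + 1) ^ 2 * π ^ 2 * t)) *
        -(((n : ℝ) + 1) ^ 2 * π ^ 2)) * Real.sin (((n : ℝ) + 1) * π * x) ^ 2 := by
  simp_rw [deriv_deriv_heatKernel ht, heatKernel_eq_tsum_mul_sin]
  rw [integral_tsum_mul_sin_mul_tsum_mul_sin (summable_abs_heatKernel_coeff ht x)
    (summable_abs_heatKernel_deriv_coeff ht x)]
  refine tsum_congr fun n => ?_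
  rw [show Real.exp (-(((n : ℝ) + 1) ^ 2 * π ^ 2 * t)) =
    Real.exp (-(((n : ℝ) + 1) ^ 2 * π ^ 2 * t) / 2) *
      Real.exp (-(((n : ℝ) + 1) ^ 2 * π ^ 2 * t) / 2) by rw [← Real.exp_add]; ring_nf]
  ring

theorem hasDerivAt_tsum_exp_mul_sin_sq {t : ℝ} (ht : 0 < t) (x : ℝ) :
    HasDerivAt (fun t' => ∑' n : ℕ, 2 * Real.exp (-(((n : ℝ) + 1) ^ 2 * π ^ 2 * t')) *
        Real.sin (((n : ℝ) + 1) * π * x) ^ 2)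
      (∑' n : ℕ, 2 * (Real.exp (-(((n : ℝ) + 1) ^ 2 * π ^ 2 * t)) *
        -(((n : ℝ) + 1) ^ 2 * π ^ 2)) * Real.sin (((n : ℝ) + 1) * π * x) ^ 2) t := by
  have hmem : t ∈ Set.Ioi (t / 2) := half_lt_self ht
  refine hasDerivAt_tsum_of_isPreconnected (F := ℝ)
    (g := fun (n : ℕ) (s : ℝ) => 2 * Real.exp (-(((n : ℝ) + 1) ^ 2 * π ^ 2 * s)) *
      Real.sin (((n : ℝ) + 1) * π * x) ^ 2)
    (g' := fun (n : ℕ) (s : ℝ) => 2 * (Real.exp (-(((n : ℝ) + 1) ^ 2 * π ^ 2 * s)) *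
      -(((n : ℝ) + 1) ^ 2 * π ^ 2)) * Real.sin (((n : ℝ) + 1) * π * x) ^ 2)
    (summable_const_mul_pow_mul_exp (2 * π ^ 2) 2 ht)
    isOpen_Ioi isPreconnected_Ioi (fun n s _ => ?_) (fun n s hs => ?_) hmem ?_ hmem
  · have h : HasDerivAt (fun s : ℝ => -(((n : ℝ) + 1) ^ 2 * π ^ 2 * s))
        (-(((n : ℝ) + 1) ^ 2 * π ^ 2)) s := by
      simpa using (hasDerivAt_id s).const_mul (-(((n : ℝ) + 1) ^ 2 * π ^ 2))
    exact (h.exp.const_mul _).mul_const _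
  · rw [Real.norm_eq_abs, mul_neg, mul_neg, neg_mul, abs_neg, abs_of_nonneg (by positivity)]
    refine (mul_le_of_le_one_right (by positivity) (Real.sin_sq_le_one _)).trans ?_
    rw [show 2 * (Real.exp (-(((n : ℝ) + 1) ^ 2 * π ^ 2 * s)) * (((n : ℝ) + 1) ^ 2 * π ^ 2)) =
      2 * π ^ 2 * (((n : ℝ) + 1) ^ 2 * Real.exp (-(((n : ℝ) + 1) ^ 2 * π ^ 2 * s))) by ring]
    gcongr
    rw [neg_div, mul_div_assoc]
    have := le_of_lt (Set.mem_Ioi.mp hs)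
    gcongr
  · refine Summable.of_nonneg_of_le (fun n => by positivity) (fun n => ?_)
      (summable_const_mul_pow_mul_exp 2 0 ht)
    refine (mul_le_of_le_one_right (by positivity) (Real.sin_sq_le_one _)).trans ?_
    rw [pow_zero, one_mul, neg_div]
    gcongr
    exact half_le_self (by positivity)

/-- For every `t > 0` and `x ∈ ℝ`, the function `t ↦ ∫₀¹ g_t(x,y)² dy` is differentiable and
`∂/∂t ∫₀¹ g_t(x,y)² dy = ∫₀¹ g_t(x,y)·(∂²/∂x² g_t)(x,y) dy
  = −∑_{n=1}^∞ 2 n²π² exp(−n²π²t) sin²(nπx)`,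
where `∂²/∂x² g_t` is the second derivative of `g_t` in its first spatial variable. -/
theorem heatKernel_sq_integral_deriv (t : ℝ) (ht : 0 < t) (x : ℝ) :
    HasDerivAt (fun t' => ∫ y in (0:ℝ)..1, (heatKernel t' x y) ^ 2)
      (∫ y in (0:ℝ)..1, heatKernel t x y * deriv (deriv fun x' => heatKernel t x' y) x) t ∧
    (∫ y in (0:ℝ)..1, heatKernel t x y * deriv (deriv fun x' => heatKernel t x' y) x) =
      -∑' n : ℕ, 2 * (((n : ℝ) + 1) ^ 2 * π ^ 2) * Real.exp (-(((n : ℝ) + 1) ^ 2 * π ^ 2 * t)) *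
        Real.sin (((n : ℝ) + 1) * π * x) ^ 2 := by
  rw [integral_heatKernel_mul_deriv_deriv ht x]
  refine ⟨(hasDerivAt_tsum_exp_mul_sin_sq ht x).congr_of_eventuallyEq ?_, ?_⟩
  · filter_upwards [lt_mem_nhds ht] with s hs using integral_heatKernel_sq hs x
  · rw [← tsum_neg]
    exact tsum_congr fun n => by ring
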